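/- (Fractional Gagliardo–Nirenberg/Brezis–Mironescu interpolation inequality) Let n ≥ 1 and s ∈ (0,1). There exists a constant C > 0, depending only on n and s, such that for every smooth compactly supported function u : ℝⁿ → ℝ one has ∫_{ℝⁿ} ∫_{ℝⁿ} |u(x) − u(y)|² / |x−y|^{n+2s} dx dy ≤ C · (∫_{ℝⁿ} |u|² dx)^{1-s} · (∫_{ℝⁿ} |u|² dx + ∫_{ℝⁿ} |∇u|² dx)^{s}. -/

import Mathlib

open MeasureTheory
open scoped ENNReal

noncomputable section

lemma sq_intervalIntegral_zero_one_le {g : ℝ → ℝ} (hg : Continuous g) :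
    (∫ t in (0 : ℝ)..1, g t) ^ 2 ≤ ∫ t in (0 : ℝ)..1, g t ^ 2 := by
  set c := ∫ t in (0 : ℝ)..1, g t with hc
  have h0 : 0 ≤ ∫ t in (0 : ℝ)..1, (g t - c) ^ 2 :=
    intervalIntegral.integral_nonneg zero_le_one fun t _ => sq_nonneg _
  have h1 : ∫ t in (0 : ℝ)..1, (g t - c) ^ 2
      = (∫ t in (0 : ℝ)..1, g t ^ 2) - 2 * c * c + c ^ 2 := by
    have h2 : ∀ t, (g t - c) ^ 2 = g t ^ 2 - 2 * c * g t + c ^ 2 := fun t => by ring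
    simp_rw [h2]
    rw [intervalIntegral.integral_add, intervalIntegral.integral_sub,
      intervalIntegral.integral_const_mul, ← hc]
    · simp
    all_goals exact Continuous.intervalIntegrable (by fun_prop) _ _
  nlinarith

lemma lintegral_sq_sub_translate_le {E : Type*} [NormedAddCommGroup E] [MeasurableSpace E]
    [BorelSpace E] (μ : Measure E) [μ.IsAddRightInvariant]
    {u : E → ℝ} (hu : Continuous u) (h : E) :
    ∫⁻ x, ENNReal.ofReal ((u (x + h) - u x) ^ 2) ∂μ
      ≤ 4 * ∫⁻ x, ENNReal.ofReal (u x ^ 2) ∂μ := by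
  have hpt : ∀ x, ENNReal.ofReal ((u (x + h) - u x) ^ 2)
      ≤ 2 * ENNReal.ofReal (u (x + h) ^ 2) + 2 * ENNReal.ofReal (u x ^ 2) := by
    intro x
    rw [← ENNReal.ofReal_ofNat 2, ← ENNReal.ofReal_mul (by norm_num),
      ← ENNReal.ofReal_mul (by norm_num), ← ENNReal.ofReal_add (by positivity) (by positivity)]
    exact ENNReal.ofReal_le_ofReal (by nlinarith [sq_nonneg (u (x + h) + u x)])
  refine (lintegral_mono hpt).trans_eq ?_
  rw [lintegral_add_right _ (by fun_prop),
    lintegral_const_mul' _ _ (by simp), lintegral_const_mul' _ _ (by simp),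
    lintegral_add_right_eq_self (fun x => ENNReal.ofReal (u x ^ 2)) h, ← add_mul]
  norm_num

section Translate

variable {E : Type*} [NormedAddCommGroup E] [NormedSpace ℝ E]

lemma sq_sub_le_integral_sq_fderiv {u : E → ℝ} (hu : ContDiff ℝ 1 u) (x h : E) :
    (u (x + h) - u x) ^ 2 ≤ ‖h‖ ^ 2 * ∫ t in (0 : ℝ)..1, ‖fderiv ℝ u (x + t • h)‖ ^ 2 := by
  have hd : Continuous (fderiv ℝ u) := hu.continuous_fderiv one_ne_zero
  have hderiv : ∀ t : ℝ, HasDerivAt (fun t : ℝ => u (x + t • h)) (fderiv ℝ u (x + t • h) h) t := by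
    intro t
    have h1 : HasDerivAt (fun t : ℝ => x + t • h) h t := by
      simpa using ((hasDerivAt_id t).smul_const h).const_add x
    exact ((hu.differentiable one_ne_zero) _).hasFDerivAt.comp_hasDerivAt t h1
  have hcont : Continuous fun t : ℝ => fderiv ℝ u (x + t • h) h := by fun_prop
  have hftc : u (x + h) - u x = ∫ t in (0 : ℝ)..1, fderiv ℝ u (x + t • h) h := by
    rw [intervalIntegral.integral_eq_sub_of_hasDerivAt (fun t _ => hderiv t)
      (hcont.intervalIntegrable _ _)]
    simp
  rw [hftc, ← intervalIntegral.integral_const_mul]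
  refine (sq_intervalIntegral_zero_one_le hcont).trans ?_
  refine intervalIntegral.integral_mono_on zero_le_one
    ((hcont.pow 2).intervalIntegrable _ _)
    (Continuous.intervalIntegrable (by fun_prop) _ _) fun t _ => ?_
  rw [← mul_pow, mul_comm, ← sq_abs]
  exact pow_le_pow_left₀ (abs_nonneg _) ((fderiv ℝ u (x + t • h)).le_opNorm h) 2

variable [MeasurableSpace E] [BorelSpace E] (μ : Measure E) [μ.IsAddRightInvariant]

lemma lintegral_sq_sub_translate_le_fderiv [FiniteDimensional ℝ E] [SFinite μ]
    {u : E → ℝ} (hu : ContDiff ℝ 1 u) (h : E) :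
    ∫⁻ x, ENNReal.ofReal ((u (x + h) - u x) ^ 2) ∂μ
      ≤ ENNReal.ofReal (‖h‖ ^ 2) * ∫⁻ x, ENNReal.ofReal (‖fderiv ℝ u x‖ ^ 2) ∂μ := by
  have hd : Continuous (fderiv ℝ u) := hu.continuous_fderiv one_ne_zero
  have hpt : ∀ x, ENNReal.ofReal ((u (x + h) - u x) ^ 2) ≤ ENNReal.ofReal (‖h‖ ^ 2) *
      ∫⁻ t in Set.Ioc (0 : ℝ) 1, ENNReal.ofReal (‖fderiv ℝ u (x + t • h)‖ ^ 2) := by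
    intro x
    have hc : Continuous fun t : ℝ => ‖fderiv ℝ u (x + t • h)‖ ^ 2 := by fun_prop
    rw [← ofReal_integral_eq_lintegral_ofReal
        ((intervalIntegrable_iff_integrableOn_Ioc_of_le zero_le_one).1 (hc.intervalIntegrable _ _))
        (.of_forall fun t => by positivity),
      ← intervalIntegral.integral_of_le zero_le_one, ← ENNReal.ofReal_mul (by positivity)]
    exact ENNReal.ofReal_le_ofReal (sq_sub_le_integral_sq_fderiv hu x h)
  refine (lintegral_mono hpt).trans ?_
  rw [lintegral_const_mul' _ _ ENNReal.ofReal_ne_top, lintegral_lintegral_swap]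
  · refine le_of_eq ?_
    congr 1
    simp_rw [fun t : ℝ => lintegral_add_right_eq_self (μ := μ)
      (fun x => ENNReal.ofReal (‖fderiv ℝ u x‖ ^ 2)) (t • h)]
    simp
  · have : Continuous fun p : E × ℝ => ‖fderiv ℝ u (p.1 + p.2 • h)‖ ^ 2 := by fun_prop
    exact this.measurable.ennreal_ofReal.aemeasurable

end Translate

section Kernel

variable {E : Type*} [NormedAddCommGroup E] [NormedSpace ℝ E] [FiniteDimensional ℝ E]
  [MeasurableSpace E] [BorelSpace E] (μ : Measure E) [μ.IsAddHaarMeasure]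

open Module in
lemma integrable_min_four_sq_norm_div_rpow [Nontrivial E] {s : ℝ} (hs : s ∈ Set.Ioo (0 : ℝ) 1) :
    Integrable (fun x : E => min 4 (‖x‖ ^ 2) / ‖x‖ ^ ((finrank ℝ E : ℝ) + 2 * s)) μ := by
  obtain ⟨hs0, hs1⟩ := hs
  have hn : 1 ≤ finrank ℝ E := finrank_pos
  refine (integrable_fun_norm_addHaar μ
    (f := fun r : ℝ => min 4 (r ^ 2) / r ^ ((finrank ℝ E : ℝ) + 2 * s))).2 ?_
  have hmeas : Measurable fun r : ℝ =>
      r ^ (finrank ℝ E - 1) • (min 4 (r ^ 2) / r ^ ((finrank ℝ E : ℝ) + 2 * s)) := by fun_prop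
  have heq : ∀ r : ℝ, 0 < r →
      r ^ (finrank ℝ E - 1) • (min 4 (r ^ 2) / r ^ ((finrank ℝ E : ℝ) + 2 * s))
        = min 4 (r ^ 2) * r ^ (-1 - 2 * s) := by
    intro r hr
    have h1 : r ^ (finrank ℝ E - 1) = r ^ ((finrank ℝ E : ℝ) - 1) := by
      rw [← Real.rpow_natCast, Nat.cast_sub hn, Nat.cast_one]
    rw [smul_eq_mul, h1, div_eq_mul_inv, ← Real.rpow_neg hr.le, mul_left_comm,
      ← Real.rpow_add hr]
    ring_nf
  rw [← Set.Ioc_union_Ioi_eq_Ioi zero_le_one]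
  refine IntegrableOn.union ?_ ?_
  · have hint : IntegrableOn (fun r : ℝ => r ^ (1 - 2 * s)) (Set.Ioc 0 1) :=
      (intervalIntegrable_iff_integrableOn_Ioc_of_le zero_le_one).1
        (intervalIntegral.intervalIntegrable_rpow' (by linarith))
    refine hint.mono' hmeas.aestronglyMeasurable ?_
    filter_upwards [ae_restrict_mem measurableSet_Ioc] with r hr
    have hr0 : 0 < r := hr.1
    rw [heq r hr0, Real.norm_of_nonneg (by positivity)]
    calc min 4 (r ^ 2) * r ^ (-1 - 2 * s) ≤ r ^ (2 : ℝ) * r ^ (-1 - 2 * s) := by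
          gcongr
          rw [Real.rpow_two]
          exact min_le_right _ _
      _ = r ^ (1 - 2 * s) := by
          rw [← Real.rpow_add hr0]
          ring_nf
  · have hint : IntegrableOn (fun r : ℝ => 4 * r ^ (-1 - 2 * s)) (Set.Ioi 1) :=
      (integrableOn_Ioi_rpow_of_lt (by linarith) one_pos).const_mul 4
    refine hint.mono' hmeas.aestronglyMeasurable ?_
    filter_upwards [ae_restrict_mem measurableSet_Ioi] with r hr
    have hr0 : 0 < r := one_pos.trans hr
    rw [heq r hr0, Real.norm_of_nonneg (by positivity)]
    gcongr
    exact min_le_left _ _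

open Module in
lemma lintegral_comp_smul_eq {r : ℝ} (hr : 0 < r) (f : E → ℝ≥0∞) (hf : Measurable f) :
    ∫⁻ x, f x ∂μ = ENNReal.ofReal (r ^ finrank ℝ E) * ∫⁻ x, f (r • x) ∂μ := by
  rw [← lintegral_map hf (measurable_const_smul r), Measure.map_addHaar_smul μ hr.ne',
    lintegral_smul_measure, smul_eq_mul, ← mul_assoc, ← ENNReal.ofReal_mul (by positivity),
    abs_of_pos (by positivity), mul_inv_cancel₀ (by positivity)]
  simp

open Module in
lemma lintegral_min_div_rpow_eq (s : ℝ) {a b : ℝ} (ha : 0 < a) (hb : 0 < b) :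
    ∫⁻ x : E, ENNReal.ofReal
        (min (4 * a) (‖x‖ ^ 2 * b) / ‖x‖ ^ ((finrank ℝ E : ℝ) + 2 * s)) ∂μ
      = ENNReal.ofReal (a ^ (1 - s) * b ^ s) * ∫⁻ x : E, ENNReal.ofReal
        (min 4 (‖x‖ ^ 2) / ‖x‖ ^ ((finrank ℝ E : ℝ) + 2 * s)) ∂μ := by
  set r := √(a / b) with hr_def
  have hr : 0 < r := Real.sqrt_pos.2 (by positivity)
  have hr2 : r ^ 2 * b = a := by
    rw [hr_def, Real.sq_sqrt (by positivity)]
    field_simp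
  have hscale : a ^ (1 - s) * b ^ s = a * r ^ (-(2 * s)) := by
    have h1 : r ^ (-(2 * s)) = (a / b) ^ (-s) := by
      rw [hr_def, Real.sqrt_eq_rpow, ← Real.rpow_mul (by positivity)]
      ring_nf
    rw [h1, Real.div_rpow ha.le hb.le, Real.rpow_neg hb.le, div_inv_eq_mul, sub_eq_add_neg,
      Real.rpow_add ha, Real.rpow_one, mul_assoc]
  have hpt : ∀ x : E, ENNReal.ofReal
        (min (4 * a) (‖r • x‖ ^ 2 * b) / ‖r • x‖ ^ ((finrank ℝ E : ℝ) + 2 * s))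
      = ENNReal.ofReal (a * r ^ (-((finrank ℝ E : ℝ) + 2 * s))) * ENNReal.ofReal
        (min 4 (‖x‖ ^ 2) / ‖x‖ ^ ((finrank ℝ E : ℝ) + 2 * s)) := by
    intro x
    rw [← ENNReal.ofReal_mul (by positivity), norm_smul, Real.norm_of_nonneg hr.le,
      Real.mul_rpow hr.le (norm_nonneg x), Real.rpow_neg hr.le, mul_pow, mul_right_comm, hr2,
      mul_comm 4 a, ← mul_min_of_nonneg _ _ ha.le]
    congr 1
    ring
  rw [lintegral_comp_smul_eq μ hr _ (by fun_prop)]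
  simp_rw [hpt]
  rw [lintegral_const_mul' _ _ ENNReal.ofReal_ne_top, ← mul_assoc,
    ← ENNReal.ofReal_mul (by positivity), hscale, mul_left_comm, ← Real.rpow_natCast r,
    ← Real.rpow_add hr]
  ring_nf

end Kernel

section Gagliardo

variable {E : Type*} [NormedAddCommGroup E] [NormedSpace ℝ E] [FiniteDimensional ℝ E]
  [MeasurableSpace E] [BorelSpace E] (μ : Measure E) [μ.IsAddHaarMeasure]

lemma lintegral_sq_sub_div_rpow_eq {u : E → ℝ} (hu : Continuous u) (p : ℝ) :
    ∫⁻ x, ∫⁻ y, ENNReal.ofReal ((u x - u y) ^ 2 / ‖x - y‖ ^ p) ∂μ ∂μ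
      = ∫⁻ h, ENNReal.ofReal (‖h‖ ^ p)⁻¹ *
          ∫⁻ x, ENNReal.ofReal ((u (x + h) - u x) ^ 2) ∂μ ∂μ := by
  calc ∫⁻ x, ∫⁻ y, ENNReal.ofReal ((u x - u y) ^ 2 / ‖x - y‖ ^ p) ∂μ ∂μ
      = ∫⁻ x, ∫⁻ h, ENNReal.ofReal (‖h‖ ^ p)⁻¹ *
          ENNReal.ofReal ((u (x + h) - u x) ^ 2) ∂μ ∂μ := by
        refine lintegral_congr fun x => ?_
        rw [← lintegral_add_left_eq_self _ x]
        refine lintegral_congr fun h => ?_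
        rw [← ENNReal.ofReal_mul (by positivity), sub_add_cancel_left, norm_neg, div_eq_inv_mul,
          sub_sq_comm]
    _ = _ := by
        rw [lintegral_lintegral_swap (Measurable.aemeasurable (by fun_prop))]
        simp_rw [lintegral_const_mul' _ _ ENNReal.ofReal_ne_top]

open Module in
/-- The interpolation inequality with an explicit constant. -/
lemma lintegral_gagliardo_le {u : E → ℝ} (hu : ContDiff ℝ 1 u) (hsupp : HasCompactSupport u)
    (s : ℝ) :
    ∫⁻ x, ∫⁻ y, ENNReal.ofReal
        ((u x - u y) ^ 2 / ‖x - y‖ ^ ((finrank ℝ E : ℝ) + 2 * s)) ∂μ ∂μ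
      ≤ (∫⁻ x : E, ENNReal.ofReal
          (min 4 (‖x‖ ^ 2) / ‖x‖ ^ ((finrank ℝ E : ℝ) + 2 * s)) ∂μ) *
        (∫⁻ x, ENNReal.ofReal (u x ^ 2) ∂μ) ^ (1 - s) *
        (∫⁻ x, ENNReal.ofReal (u x ^ 2) ∂μ +
          ∫⁻ x, ENNReal.ofReal (‖fderiv ℝ u x‖ ^ 2) ∂μ) ^ s := by
  rw [lintegral_sq_sub_div_rpow_eq μ hu.continuous]
  set A := ∫⁻ x, ENNReal.ofReal (u x ^ 2) ∂μ with hA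
  set B := A + ∫⁻ x, ENNReal.ofReal (‖fderiv ℝ u x‖ ^ 2) ∂μ with hB
  have hd : Continuous (fderiv ℝ u) := hu.continuous_fderiv one_ne_zero
  have hA_top : A ≠ ∞ := by
    have hc : HasCompactSupport fun x => u x ^ 2 :=
      hsupp.comp_left (g := fun t : ℝ => t ^ 2) (by simp)
    have hint : Integrable (fun x => u x ^ 2) μ :=
      (hu.continuous.pow 2).integrable_of_hasCompactSupport hc
    exact hint.lintegral_lt_top.ne
  have hB_top : B ≠ ∞ := by
    have hc : HasCompactSupport fun x => ‖fderiv ℝ u x‖ ^ 2 :=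
      (hsupp.fderiv ℝ).comp_left (g := fun L : E →L[ℝ] ℝ => ‖L‖ ^ 2) (by simp)
    have hint : Integrable (fun x => ‖fderiv ℝ u x‖ ^ 2) μ :=
      (hd.norm.pow 2).integrable_of_hasCompactSupport hc
    exact ENNReal.add_ne_top.2 ⟨hA_top, hint.lintegral_lt_top.ne⟩
  have hD : ∀ h, ∫⁻ x, ENNReal.ofReal ((u (x + h) - u x) ^ 2) ∂μ
      ≤ min (4 * A) (ENNReal.ofReal (‖h‖ ^ 2) * B) := fun h =>
    le_min (lintegral_sq_sub_translate_le μ hu.continuous h)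
      ((lintegral_sq_sub_translate_le_fderiv μ hu h).trans (by gcongr; exact le_add_self))
  refine (lintegral_mono fun h => mul_le_mul_right (hD h) _).trans ?_
  rcases eq_or_ne A 0 with hA0 | hA0
  · simp [hA0]
  have ha : 0 < A.toReal := ENNReal.toReal_pos hA0 hA_top
  have hb : 0 < B.toReal := ENNReal.toReal_pos (fun h0 => hA0 (add_eq_zero.1 h0).1) hB_top
  refine le_of_eq ?_
  calc _ = ∫⁻ h : E, ENNReal.ofReal (min (4 * A.toReal) (‖h‖ ^ 2 * B.toReal) /
        ‖h‖ ^ ((finrank ℝ E : ℝ) + 2 * s)) ∂μ := by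
        refine lintegral_congr fun h => ?_
        rw [div_eq_inv_mul, ENNReal.ofReal_mul (by positivity), ENNReal.ofReal_min,
          ENNReal.ofReal_mul (by norm_num), ENNReal.ofReal_mul (by positivity),
          ENNReal.ofReal_toReal hA_top, ENNReal.ofReal_toReal hB_top, ENNReal.ofReal_ofNat]
    _ = _ := by
        rw [lintegral_min_div_rpow_eq μ s ha hb, ENNReal.ofReal_mul (by positivity),
          ← ENNReal.ofReal_rpow_of_pos ha, ← ENNReal.ofReal_rpow_of_pos hb,
          ENNReal.ofReal_toReal hA_top, ENNReal.ofReal_toReal hB_top]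
        ring

end Gagliardo

/-- **Fractional Gagliardo–Nirenberg / Brezis–Mironescu interpolation inequality.**
Let `n ≥ 1` and `s ∈ (0,1)`.  There is a constant `C > 0`, depending only on `n` and `s`,
such that for every smooth compactly supported `u : ℝⁿ → ℝ`,
`∫∫ |u x - u y|² / |x - y|^(n+2s) dx dy ≤ C * (∫ |u|²)^(1-s) * (∫ |u|² + ∫ |∇u|²)^s`. -/
theorem brezis_mironescu_interpolation (n : ℕ) (hn : 1 ≤ n)
    (s : ℝ) (hs : s ∈ Set.Ioo (0:ℝ) 1) :
    ∃ C > (0:ℝ), ∀ u : EuclideanSpace ℝ (Fin n) → ℝ,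
      ContDiff ℝ (⊤ : ℕ∞) u → HasCompactSupport u →
      (∫⁻ x, ∫⁻ y, ENNReal.ofReal ((u x - u y) ^ 2 / ‖x - y‖ ^ ((n : ℝ) + 2 * s))) ≤
        ENNReal.ofReal C *
          (∫⁻ x, ENNReal.ofReal ((u x) ^ 2)) ^ (1 - s) *
          ((∫⁻ x, ENNReal.ofReal ((u x) ^ 2)) +
            ∫⁻ x, ENNReal.ofReal (‖fderiv ℝ u x‖ ^ 2)) ^ s := by
  have : Nonempty (Fin n) := ⟨⟨0, hn⟩⟩
  set K := ∫⁻ x : EuclideanSpace ℝ (Fin n), ENNReal.ofReal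
    (min 4 (‖x‖ ^ 2) / ‖x‖ ^ ((n : ℝ) + 2 * s)) with hK
  have hK_top : K ≠ ∞ := by
    have hint := integrable_min_four_sq_norm_div_rpow
      (volume : Measure (EuclideanSpace ℝ (Fin n))) hs
    rw [finrank_euclideanSpace_fin] at hint
    exact hint.lintegral_lt_top.ne
  refine ⟨K.toReal + 1, by positivity, fun u hu hsupp => ?_⟩
  have hmain := lintegral_gagliardo_le volume (hu.of_le (by exact_mod_cast le_top)) hsupp s
  rw [finrank_euclideanSpace_fin, ← hK] at hmain
  refine hmain.trans ?_
  gcongr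
  exact (ENNReal.le_ofReal_iff_toReal_le hK_top (by positivity)).2 (by linarith)

end
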